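/- arXiv:1712.05577 — 5 statements merged into one kernel-verified Lean document; each statement's English description precedes it below -/
import Mathlib

section
/- Let W = L·U be a random m×n real matrix, where U is uniformly distributed on the unit sphere of the space of m×n matrices with the Frobenius norm and L is a positive random scalar independent of U (i.e. the distribution of W is radially symmetric). Then for every fixed v ∈ ℝⁿ: E[ ‖Wv‖₂² / ‖W‖_F² ] = ‖v‖₂²/n. Equivalently, the inverse quadratic expectation of ‖W‖_F·‖v‖₂/(√n·‖Wv‖₂) equals 1, i.e. (E[ n·‖Wv‖₂²/(‖W‖_F²·‖v‖₂²) ])^{−1/2} = 1 (for v ≠ 0). -/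
open MeasureTheory ProbabilityTheory Matrix

/-- `μ` is the uniform distribution on the sphere of radius `R`. -/
def UniformOnSphere {ι : Type*} [Fintype ι]
    (μ : Measure (EuclideanSpace ℝ ι)) (R : ℝ) : Prop :=
  IsProbabilityMeasure μ ∧ μ (Metric.sphere (0 : EuclideanSpace ℝ ι) R)ᶜ = 0 ∧
    ∀ T : EuclideanSpace ℝ ι ≃ₗᵢ[ℝ] EuclideanSpace ℝ ι, μ.map T = μ

namespace UniformOnSphere

variable {ι : Type*} [Fintype ι] {μ : Measure (EuclideanSpace ℝ ι)} {R : ℝ}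

theorem ae_norm_eq (h : UniformOnSphere μ R) : ∀ᵐ x ∂μ, ‖x‖ = R := by
  have h2 : ∀ᵐ x ∂μ, x ∈ Metric.sphere (0 : EuclideanSpace ℝ ι) R := mem_ae_iff.2 h.2.1
  filter_upwards [h2] with x hx
  simpa using hx

theorem integrable_coord_mul_coord (h : UniformOnSphere μ R) (p q : ι) :
    Integrable (fun x => x p * x q) μ := by
  have := h.1
  refine Integrable.of_bound (C := R * R) (by fun_prop) ?_
  filter_upwards [h.ae_norm_eq] with x hx
  rw [norm_mul, ← hx]
  gcongr <;> exact PiLp.norm_apply_le x _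

theorem integral_comp_isometry (h : UniformOnSphere μ R)
    (T : EuclideanSpace ℝ ι ≃ₗᵢ[ℝ] EuclideanSpace ℝ ι) (f : EuclideanSpace ℝ ι → ℝ) :
    ∫ x, f (T x) ∂μ = ∫ x, f x ∂μ := by
  conv_rhs => rw [← h.2.2 T]
  exact (T.toHomeomorph.measurableEmbedding.integral_map f).symm

theorem integral_coord_mul_coord_of_ne (h : UniformOnSphere μ R) {p q : ι} (hpq : p ≠ q) :
    ∫ x, x p * x q ∂μ = 0 := by
  classical
  let T : EuclideanSpace ℝ ι ≃ₗᵢ[ℝ] EuclideanSpace ℝ ι :=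
    LinearIsometryEquiv.piLpCongrRight 2 fun i =>
      if i = p then LinearIsometryEquiv.neg ℝ else LinearIsometryEquiv.refl ℝ ℝ
  have key := h.integral_comp_isometry T fun x => x p * x q
  have hT : ∀ x, T x p * T x q = -(x p * x q) := fun x => by
    simp [T, LinearIsometryEquiv.piLpCongrRight_apply, hpq.symm]
  simp only [hT, integral_neg] at key
  linarith

theorem integral_coord_sq_eq (h : UniformOnSphere μ R) (p q : ι) :
    ∫ x, x p * x p ∂μ = ∫ x, x q * x q ∂μ := by
  classical
  have key := h.integral_comp_isometry
    (LinearIsometryEquiv.piLpCongrLeft 2 ℝ ℝ (Equiv.swap p q)) fun x => x q * x q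
  simpa [LinearIsometryEquiv.piLpCongrLeft_apply, Equiv.piCongrLeft'] using key

theorem integral_coord_sq (h : UniformOnSphere μ R) (p : ι) :
    ∫ x, x p * x p ∂μ = R ^ 2 / Fintype.card ι := by
  have := h.1
  have : Nonempty ι := ⟨p⟩
  have hsum : ∑ q, ∫ x, x q * x q ∂μ = R ^ 2 := by
    rw [← integral_finsetSum _ fun q _ => h.integrable_coord_mul_coord q q]
    calc ∫ x, ∑ q, x q * x q ∂μ = ∫ _, R ^ 2 ∂μ := by
          refine integral_congr_ae ?_
          filter_upwards [h.ae_norm_eq] with x hx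
          simp [← hx, EuclideanSpace.real_norm_sq_eq, ← sq]
      _ = R ^ 2 := by simp
  rw [Finset.sum_congr rfl fun q _ => h.integral_coord_sq_eq q p] at hsum
  rw [eq_div_iff (by positivity), ← hsum]
  simp [mul_comm]

/-- The squared norm of the image of a fixed vector under a matrix uniformly distributed on a
Frobenius sphere. -/
theorem integral_sum_sq_mulVec {κ ν : Type*} [Fintype κ] [Fintype ν]
    {μ : Measure (EuclideanSpace ℝ (κ × ν))} (h : UniformOnSphere μ R) (v : ν → ℝ) :
    ∫ x, ∑ i, (∑ j, x (i, j) * v j) ^ 2 ∂μ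
      = Fintype.card κ * (R ^ 2 / Fintype.card (κ × ν)) * ∑ j, v j ^ 2 := by
  classical
  have hexp : ∀ x : EuclideanSpace ℝ (κ × ν), ∑ i, (∑ j, x (i, j) * v j) ^ 2
      = ∑ i, ∑ j, ∑ k, v j * v k * (x (i, j) * x (i, k)) := fun x => by
    refine Finset.sum_congr rfl fun i _ => ?_
    rw [sq, Finset.sum_mul_sum]
    exact Finset.sum_congr rfl fun j _ => Finset.sum_congr rfl fun k _ => by ring
  have hint : ∀ i j k, Integrable
      (fun x : EuclideanSpace ℝ (κ × ν) => v j * v k * (x (i, j) * x (i, k))) μ :=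
    fun i j k => (h.integrable_coord_mul_coord _ _).const_mul _
  have hmoment : ∀ i j k, ∫ x, v j * v k * (x (i, j) * x (i, k)) ∂μ
      = if j = k then R ^ 2 / Fintype.card (κ × ν) * v j ^ 2 else 0 := fun i j k => by
    rw [integral_const_mul]
    split_ifs with hjk
    · subst hjk
      rw [h.integral_coord_sq]
      ring
    · rw [h.integral_coord_mul_coord_of_ne (by simpa using hjk), mul_zero]
  simp_rw [hexp]
  rw [integral_finsetSum _ fun i _ => integrable_finsetSum _ fun j _ =>
    integrable_finsetSum _ fun k _ => hint i j k]
  simp_rw [integral_finsetSum _ fun j _ => integrable_finsetSum _ fun k _ => hint _ j k,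
    integral_finsetSum _ fun k _ => hint _ _ k, hmoment]
  simp [← Finset.mul_sum, mul_assoc]

end UniformOnSphere

/-- Let `W = L • U` be a radially symmetric random `m × n` matrix,
where `U` is uniformly distributed on the Frobenius-unit sphere and `L` is a positive
random scalar independent of `U`.  Then for every fixed `v`:
`E[‖Wv‖₂² / ‖W‖_F²] = ‖v‖₂² / n`. -/
theorem radially_symmetric_matrix_vec_expectation {m n : ℕ}
    {Ω : Type*} [MeasurableSpace Ω] (P : Measure Ω) [IsProbabilityMeasure P]
    (l : Ω → ℝ) (U : Ω → EuclideanSpace ℝ (Fin m × Fin n))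
    (hlmeas : Measurable l) (hUmeas : Measurable U)
    (hl : ∀ᵐ ω ∂P, 0 < l ω)
    (hindep : IndepFun l U P)
    (hUdist : UniformOnSphere (P.map U) 1)
    (v : EuclideanSpace ℝ (Fin n)) :
    ∫ ω, ‖Matrix.toEuclideanLin (l ω • Matrix.of fun i j => U ω (i, j)) v‖ ^ 2
        / (∑ i, ∑ j, (l ω • Matrix.of fun i j => U ω (i, j)) i j ^ 2) ∂P
      = ‖v‖ ^ 2 / n := by
  have hnorm : ∀ᵐ ω ∂P, ‖U ω‖ = 1 := ae_of_ae_map hUmeas.aemeasurable hUdist.ae_norm_eq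
  have hreduce : ∀ᵐ ω ∂P,
      ‖Matrix.toEuclideanLin (l ω • Matrix.of fun i j => U ω (i, j)) v‖ ^ 2
        / (∑ i, ∑ j, (l ω • Matrix.of fun i j => U ω (i, j)) i j ^ 2)
      = ∑ i, (∑ j, U ω (i, j) * v j) ^ 2 := by
    filter_upwards [hl, hnorm] with ω hlω hω
    have hden : ∑ i, ∑ j, (l ω • Matrix.of fun i j => U ω (i, j)) i j ^ 2 = l ω ^ 2 := by
      have hsq := EuclideanSpace.real_norm_sq_eq (U ω)
      rw [hω, Fintype.sum_prod_type] at hsq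
      simp [mul_pow, ← Finset.mul_sum, ← hsq]
    have hnum : ‖Matrix.toEuclideanLin (l ω • Matrix.of fun i j => U ω (i, j)) v‖ ^ 2
        = l ω ^ 2 * ∑ i, (∑ j, U ω (i, j) * v j) ^ 2 := by
      simp [EuclideanSpace.real_norm_sq_eq, Matrix.mulVec, dotProduct, mul_assoc,
        ← Finset.mul_sum, mul_pow]
    rw [hden, hnum, mul_div_cancel_left₀ _ (by positivity)]
  rw [integral_congr_ae hreduce, ← integral_map hUmeas.aemeasurable
    (f := fun x : EuclideanSpace ℝ (Fin m × Fin n) => ∑ i, (∑ j, x (i, j) * v j) ^ 2)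
    (by fun_prop), hUdist.integral_sum_sq_mulVec, EuclideanSpace.real_norm_sq_eq]
  have hm : (m : ℝ) ≠ 0 := by
    rintro hm
    obtain rfl : m = 0 := by exact_mod_cast hm
    obtain ⟨ω, hω⟩ := hnorm.exists
    simp [EuclideanSpace.norm_eq] at hω
  simp only [Fintype.card_prod, Fintype.card_fin, Nat.cast_mul]
  field_simp
end

section
/- Let f_0: ℝ^{d_y}×ℝ^{d_1}→ℝ and f_l: ℝ^{p_l}×ℝ^{d_{l+1}}→ℝ^{d_l} (for 1≤l≤L) be differentiable layer functions and let R > 0. Define rescaled layer functions f'_0 = f_0, f'_1(θ_1,F_2) = f_1(Rθ_1, R²F_2), f'_l(θ_l,F_{l+1}) = R^{−l}·f_l(R^l θ_l, R^{l+1}F_{l+1}) for 2≤l≤L−1, and f'_L(θ_L,x) = R^{−L}·f_L(R^L θ_L, x). For a parameter θ = (θ_1,…,θ_L), define θ' by θ'_l = R^{−l}θ_l. Then for every input x and label y: (i) the composite layer values satisfy f'_l(θ',x) = R^{−l}·f_l(θ,x) for 2≤l≤L, f'_1(θ',x) = f_1(θ,x), and f'_0(θ',x,y) = f_0(θ,x,y),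 so f' makes the same predictions and attains the same error as f; (ii) the Jacobians of composite layer values with respect to lower layer values satisfy J'^l_k(θ',x,y) = R^{k−l}·J^l_k(θ,x,y) for 2≤l≤k≤L, J'^l_k(θ',x,y) = R^{k}·J^l_k(θ,x,y) for l∈{0,1} and 2≤k≤L, and J'^0_1(θ',x,y) = J^0_1(θ,x,y); (iii) the Jacobians with respect to parameter sub-vectors satisfy T'^l_k(θ',x,y) = R^{k−l}·T^l_k(θ,x,y) for 2≤l≤k≤L and T'^l_k(θ',x,y) = R^{k}·T^l_k(θ,x,y) for l∈{0,1}; in particular the full error gradient satisfies df'(θ',x,y)/dθ'_k = R^k·df(θ,x,y)/dθ_k for every k. -/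
/-- `netComp d g l j` is the composite `g l ∘ g (l+1) ∘ ⋯ ∘ g (l+j−1)`, mapping the
value of layer `l + j` to the value of layer `l` (each `g m` maps the value of layer
`m + 1` to the value of layer `m`). -/
def netComp (d : ℕ → ℕ)
    (g : (l : ℕ) → EuclideanSpace ℝ (Fin (d (l + 1))) → EuclideanSpace ℝ (Fin (d l)))
    (l : ℕ) : (j : ℕ) → EuclideanSpace ℝ (Fin (d (l + j))) → EuclideanSpace ℝ (Fin (d l))
  | 0 => id
  | (j + 1) => fun v => netComp d g l j (g (l + j) v)

/-- The derivative of `v ↦ c • g (a • v)` at `a⁻¹ • x` is `c * a` times that of `g` at `x`. -/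
theorem fderiv_const_smul_comp_smul {E G : Type*} [NormedAddCommGroup E] [NormedSpace ℝ E]
    [NormedAddCommGroup G] [NormedSpace ℝ G] (g : E → G) {a : ℝ} (ha : a ≠ 0) (c : ℝ) (x : E) :
    fderiv ℝ (fun v => c • g (a • v)) (a⁻¹ • x) = (c * a) • fderiv ℝ g x := by
  have h := congrFun (fderiv_const_smul_field (𝕜 := ℝ) (f := fun v => g (a • v)) c) (a⁻¹ • x)
  rw [Pi.smul_apply, fderiv_comp_smul, smul_inv_smul₀ ha, smul_smul] at h
  exact h

/-- The derivative of `v ↦ g (a • v)` at `a⁻¹ • x` is `a` times that of `g` at `x`. -/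
theorem fderiv_comp_smul_inv_smul {E G : Type*} [NormedAddCommGroup E] [NormedSpace ℝ E]
    [NormedAddCommGroup G] [NormedSpace ℝ G] (g : E → G) {a : ℝ} (ha : a ≠ 0) (x : E) :
    fderiv ℝ (fun v => g (a • v)) (a⁻¹ • x) = a • fderiv ℝ g x := by
  rw [fderiv_comp_smul, smul_inv_smul₀ ha]

/-- If each layer map satisfies `g' m v = (a m)⁻¹ • g m (a (m + 1) • v)`, then so do the
composites. -/
theorem netComp_rescale (d : ℕ → ℕ)
    (g g' : (l : ℕ) → EuclideanSpace ℝ (Fin (d (l + 1))) → EuclideanSpace ℝ (Fin (d l)))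
    (a : ℕ → ℝ) (ha : ∀ m, a m ≠ 0) (l : ℕ) :
    ∀ j, (∀ m, l ≤ m → m < l + j → ∀ v, g' m v = (a m)⁻¹ • g m (a (m + 1) • v)) →
      ∀ v, netComp d g' l j v = (a l)⁻¹ • netComp d g l j (a (l + j) • v)
  | 0, _, v => (inv_smul_smul₀ (ha l) v).symm
  | j + 1, h, v => by
    have ih := netComp_rescale d g g' a ha l j (fun m h1 h2 => h m h1 (by omega)) (g' (l + j) v)
    rw [h (l + j) (by omega) (by omega) v, smul_inv_smul₀ (ha _)] at ih
    change netComp d g' l j (g' (l + j) v) = _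
    rw [h (l + j) (by omega) (by omega) v, ih]
    rfl

/-- Rescaling the layers and parameters of a network by powers of `R`
preserves all predictions and error values, while scaling the Jacobians
`J^l_k` with respect to layer values by `R^(k−l)` (resp. `R^k` for `l ∈ {0,1}`,
`J'^0_1 = J^0_1`), and the Jacobians `T^l_k` with respect to parameter sub-vectors by
`R^(k−l)` (resp. `R^k` for `l ∈ {0,1}`); in particular the full error gradient
satisfies `df'/dθ'_k = R^k · df/dθ_k`.  Throughout, `k = l + j`. -/
theorem rescaled_network_jacobians (L : ℕ) (hL : 2 ≤ L) (d p : ℕ → ℕ) (dy : ℕ)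
    (f0 : EuclideanSpace ℝ (Fin dy) → EuclideanSpace ℝ (Fin (d 1)) → ℝ)
    (f f' : (l : ℕ) → EuclideanSpace ℝ (Fin (p l)) →
      EuclideanSpace ℝ (Fin (d (l + 1))) → EuclideanSpace ℝ (Fin (d l)))
    (R : ℝ) (hR : 0 < R)
    (θ θ' : (l : ℕ) → EuclideanSpace ℝ (Fin (p l)))
    (x : EuclideanSpace ℝ (Fin (d (L + 1)))) (y : EuclideanSpace ℝ (Fin dy))
    (hdiff : ∀ l, Differentiable ℝ
      (fun q : EuclideanSpace ℝ (Fin (p l)) × EuclideanSpace ℝ (Fin (d (l + 1))) =>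
        f l q.1 q.2))
    (hdiff0 : Differentiable ℝ (f0 y))
    -- definition of the rescaled layer functions
    (hf'1 : ∀ θ1 F2, f' 1 θ1 F2 = f 1 (R • θ1) ((R ^ 2) • F2))
    (hf'mid : ∀ l, 2 ≤ l → l ≤ L - 1 → ∀ θl F,
      f' l θl F = (R ^ l)⁻¹ • f l ((R ^ l) • θl) ((R ^ (l + 1)) • F))
    (hf'L : ∀ θL X, f' L θL X = (R ^ L)⁻¹ • f L ((R ^ L) • θL) X)
    -- definition of the rescaled parameter
    (hθ' : ∀ l, θ' l = (R ^ l)⁻¹ • θ l)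
    -- composite layer values of both networks along the forward pass
    (F F' : (l : ℕ) → EuclideanSpace ℝ (Fin (d l)))
    (hFtop : F (L + 1) = x) (hF'top : F' (L + 1) = x)
    (hF : ∀ l, 1 ≤ l → l ≤ L → F l = f l (θ l) (F (l + 1)))
    (hF' : ∀ l, 1 ≤ l → l ≤ L → F' l = f' l (θ' l) (F' (l + 1))) :
    -- (i) composite layer values, predictions and error
    (∀ l, 2 ≤ l → l ≤ L → F' l = (R ^ l)⁻¹ • F l) ∧
    F' 1 = F 1 ∧
    f0 y (F' 1) = f0 y (F 1) ∧
    -- (ii) Jacobians with respect to lower layer values, k = l + j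
    (∀ l j, 2 ≤ l → l + j ≤ L →
      fderiv ℝ (netComp d (fun m => f' m (θ' m)) l j) (F' (l + j))
        = (R ^ j : ℝ) • fderiv ℝ (netComp d (fun m => f m (θ m)) l j) (F (l + j))) ∧
    (∀ j, 1 ≤ j → 1 + j ≤ L →
      fderiv ℝ (netComp d (fun m => f' m (θ' m)) 1 j) (F' (1 + j))
        = (R ^ (1 + j) : ℝ) • fderiv ℝ (netComp d (fun m => f m (θ m)) 1 j) (F (1 + j))) ∧
    (∀ j, 1 ≤ j → 1 + j ≤ L →
      fderiv ℝ (fun v => f0 y (netComp d (fun m => f' m (θ' m)) 1 j v)) (F' (1 + j))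
        = (R ^ (1 + j) : ℝ) •
          fderiv ℝ (fun v => f0 y (netComp d (fun m => f m (θ m)) 1 j v)) (F (1 + j))) ∧
    fderiv ℝ (f0 y) (F' 1) = fderiv ℝ (f0 y) (F 1) ∧
    -- (iii) Jacobians with respect to parameter sub-vectors, k = l + j
    (∀ l j, 2 ≤ l → l + j ≤ L →
      fderiv ℝ (fun θk => netComp d (fun m => f' m (θ' m)) l j
          (f' (l + j) θk (F' (l + j + 1)))) (θ' (l + j))
        = (R ^ j : ℝ) • fderiv ℝ (fun θk => netComp d (fun m => f m (θ m)) l j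
            (f (l + j) θk (F (l + j + 1)))) (θ (l + j))) ∧
    (∀ j, 1 + j ≤ L →
      fderiv ℝ (fun θk => netComp d (fun m => f' m (θ' m)) 1 j
          (f' (1 + j) θk (F' (1 + j + 1)))) (θ' (1 + j))
        = (R ^ (1 + j) : ℝ) • fderiv ℝ (fun θk => netComp d (fun m => f m (θ m)) 1 j
            (f (1 + j) θk (F (1 + j + 1)))) (θ (1 + j))) ∧
    (∀ j, 1 + j ≤ L →
      fderiv ℝ (fun θk => f0 y (netComp d (fun m => f' m (θ' m)) 1 j
          (f' (1 + j) θk (F' (1 + j + 1))))) (θ' (1 + j))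
        = (R ^ (1 + j) : ℝ) • fderiv ℝ (fun θk => f0 y (netComp d (fun m => f m (θ m)) 1 j
            (f (1 + j) θk (F (1 + j + 1))))) (θ (1 + j))) := by
  have hR0 : ∀ m : ℕ, R ^ m ≠ 0 := fun m => pow_ne_zero m hR.ne'
  have hstep : ∀ k, 2 ≤ k → k ≤ L → (k + 1 ≤ L → F' (k + 1) = (R ^ (k + 1))⁻¹ • F (k + 1)) →
      ∀ t, f' k t (F' (k + 1)) = (R ^ k)⁻¹ • f k (R ^ k • t) (F (k + 1)) := by
    intro k h2 hkL hF1 t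
    rcases hkL.lt_or_eq with hlt | rfl
    · rw [hf'mid k h2 (by omega), hF1 hlt, smul_inv_smul₀ (hR0 _)]
    · rw [hf'L, hF'top, hFtop]
  have hval : ∀ n k, k + n = L → 2 ≤ k → F' k = (R ^ k)⁻¹ • F k := by
    intro n
    induction n with
    | zero =>
      intro k hk h2
      rw [hF' k (by omega) (by omega), hstep k h2 (by omega) (fun h => by omega), hθ',
        smul_inv_smul₀ (hR0 _), ← hF k (by omega) (by omega)]
    | succ n ih =>
      intro k hk h2
      rw [hF' k (by omega) (by omega),
        hstep k h2 (by omega) (fun _ => ih (k + 1) (by omega) (by omega)), hθ',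
        smul_inv_smul₀ (hR0 _), ← hF k (by omega) (by omega)]
  have hval' : ∀ k, 2 ≤ k → k ≤ L → F' k = (R ^ k)⁻¹ • F k := fun k h2 hk =>
    hval (L - k) k (by omega) h2
  have hlayer : ∀ k, 2 ≤ k → k ≤ L → ∀ t,
      f' k t (F' (k + 1)) = (R ^ k)⁻¹ • f k (R ^ k • t) (F (k + 1)) := fun k h2 hk =>
    hstep k h2 hk (hval' (k + 1) (by omega))
  have hlayer1 : ∀ t, f' 1 t (F' (1 + 1)) = f 1 (R ^ 1 • t) (F (1 + 1)) := by
    intro t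
    rw [hf'1, hval' (1 + 1) le_rfl hL, smul_inv_smul₀ (hR0 _), pow_one]
  have hF1 : F' 1 = F 1 := by
    rw [hF' 1 le_rfl (by omega), hlayer1, hθ', smul_inv_smul₀ (hR0 _), ← hF 1 le_rfl (by omega)]
  have hcomp : ∀ l j, 2 ≤ l → l + j ≤ L → ∀ v, netComp d (fun m => f' m (θ' m)) l j v
      = (R ^ l)⁻¹ • netComp d (fun m => f m (θ m)) l j (R ^ (l + j) • v) := by
    intro l j hl hj
    refine netComp_rescale d _ _ (fun m => R ^ m) hR0 l j fun m h1 h2 v => ?_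
    rw [hf'mid m (by omega) (by omega), hθ', smul_inv_smul₀ (hR0 _)]
  have hcomp1 : ∀ j, 1 ≤ j → 1 + j ≤ L → ∀ v, netComp d (fun m => f' m (θ' m)) 1 j v
      = netComp d (fun m => f m (θ m)) 1 j (R ^ (1 + j) • v) := by
    intro j hj hjL v
    have ha : ∀ m, (if m = 1 then 1 else R ^ m) ≠ 0 := by
      intro m
      split_ifs
      exacts [one_ne_zero, hR0 m]
    have h := netComp_rescale d (fun m => f m (θ m)) (fun m => f' m (θ' m)) _ ha 1 j ?_ v
    · simpa [show j ≠ 0 by omega] using h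
    · intro m h1 h2 v
      rcases h1.eq_or_lt with rfl | h1
      · simp [hf'1, hθ', smul_smul, hR.ne']
      · simp [hf'mid m h1 (by omega), hθ', smul_smul, hR0 m, show m ≠ 1 by omega,
          show m ≠ 0 by omega]
  have hparam1 : ∀ j, 1 + j ≤ L → ∀ t,
      netComp d (fun m => f' m (θ' m)) 1 j (f' (1 + j) t (F' (1 + j + 1)))
        = netComp d (fun m => f m (θ m)) 1 j
          (f (1 + j) (R ^ (1 + j) • t) (F (1 + j + 1))) := by
    intro j hj t
    rcases j.eq_zero_or_pos with rfl | hj0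
    · exact hlayer1 t
    · rw [hcomp1 j hj0 hj, hlayer (1 + j) (by omega) hj, smul_inv_smul₀ (hR0 _)]
  have hpow : ∀ l j : ℕ, (R ^ l)⁻¹ * R ^ (l + j) = R ^ j := fun l j => by
    rw [pow_add, inv_mul_cancel_left₀ (hR0 l)]
  refine ⟨hval', hF1, by rw [hF1], ?_, ?_, ?_, by rw [hF1], ?_, ?_, ?_⟩
  · intro l j hl hj
    rw [funext (hcomp l j hl hj), hval' (l + j) (by omega) hj,
      fderiv_const_smul_comp_smul _ (hR0 _), hpow]
  · intro j hj hjL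
    rw [funext (hcomp1 j hj hjL), hval' (1 + j) (by omega) hjL,
      fderiv_comp_smul_inv_smul _ (hR0 _)]
  · intro j hj hjL
    simp_rw [hcomp1 j hj hjL]
    rw [hval' (1 + j) (by omega) hjL]
    exact fderiv_comp_smul_inv_smul
      (fun v => f0 y (netComp d (fun m => f m (θ m)) 1 j v)) (hR0 _) _
  · intro l j hl hj
    simp_rw [hlayer (l + j) (by omega) hj, hcomp l j hl hj, smul_inv_smul₀ (hR0 (l + j))]
    rw [hθ', ← hpow l j]
    exact fderiv_const_smul_comp_smul (fun t => netComp d (fun m => f m (θ m)) l j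
      (f (l + j) t (F (l + j + 1)))) (hR0 _) _ _
  · intro j hj
    simp_rw [hparam1 j hj]
    rw [hθ']
    exact fderiv_comp_smul_inv_smul (fun t => netComp d (fun m => f m (θ m)) 1 j
      (f (1 + j) t (F (1 + j + 1)))) (hR0 _) _
  · intro j hj
    simp_rw [hparam1 j hj]
    rw [hθ']
    exact fderiv_comp_smul_inv_smul (fun t => f0 y (netComp d (fun m => f m (θ m)) 1 j
      (f (1 + j) t (F (1 + j + 1))))) (hR0 _) _
end

section
/- Let X be an ℝ^d-valued random variable with probability density p and let f: ℝ^d → ℝ^d be a continuously differentiable map whose Jacobian determinant is everywhere nonzero. (i) If f is injective, then f(X) has a density and H(f(X)) = H(X) + E_X[ log|det Df(X)| ], provided both terms on the right are finite. (ii) If instead every point of ℝ^d has at most countably many preimages under f, then f(X) has a density q satisfying q(f(x)) ≥ p(x)/|det Df(x)| for almost every x, and consequently H(f(X)) ≤ H(X) + E_X[ log|det Df(X)| ]. -/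
open MeasureTheory

open Set

open scoped ENNReal

section ChangeOfVariables

variable {E : Type*} [NormedAddCommGroup E] [NormedSpace ℝ E] [FiniteDimensional ℝ E]
  {f : E → E}

/-- A `C¹` map with nonvanishing Jacobian determinant is injective on each member of a countable
open cover. -/
theorem ContDiff.exists_countable_isOpen_injOn_cover (hf : ContDiff ℝ 1 f)
    (hdet : ∀ x, (fderiv ℝ f x).det ≠ 0) :
    ∃ (t : Set E) (U : E → Set E), t.Countable ∧ (∀ x, IsOpen (U x)) ∧ (∀ x, InjOn f (U x)) ∧
      ⋃ x ∈ t, U x = univ := by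
  have hstrict : ∀ x, HasStrictFDerivAt f
      (((fderiv ℝ f x).toContinuousLinearEquivOfDetNeZero (hdet x) : E ≃L[ℝ] E) : E →L[ℝ] E) x :=
    fun x ↦ by
      rw [ContinuousLinearMap.coe_toContinuousLinearEquivOfDetNeZero]
      exact hf.contDiffAt.hasStrictFDerivAt one_ne_zero
  have : ProperSpace E := FiniteDimensional.proper ℝ E
  obtain ⟨t, ht, htU⟩ := TopologicalSpace.countable_cover_nhds fun x ↦
    ((hstrict x).toOpenPartialHomeomorph f).open_source.mem_nhds
      (hstrict x).mem_toOpenPartialHomeomorph_source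
  exact ⟨t, fun x ↦ ((hstrict x).toOpenPartialHomeomorph f).source, ht,
    fun x ↦ ((hstrict x).toOpenPartialHomeomorph f).open_source,
    fun x ↦ ((hstrict x).toOpenPartialHomeomorph f).injOn, htU⟩

variable [MeasurableSpace E] [BorelSpace E] (ν : Measure E) [ν.IsAddHaarMeasure]

theorem ContDiff.quasiMeasurePreserving_of_det_ne_zero (hf : ContDiff ℝ 1 f)
    (hdet : ∀ x, (fderiv ℝ f x).det ≠ 0) : Measure.QuasiMeasurePreserving f ν ν := by
  have hfm : Measurable f := hf.continuous.measurable
  refine ⟨hfm, Measure.AbsolutelyContinuous.mk fun s hs hs0 ↦ ?_⟩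
  rw [Measure.map_apply hfm hs]
  obtain ⟨t, U, ht, hUo, hUinj, hU⟩ := hf.exists_countable_isOpen_injOn_cover hdet
  rw [← inter_univ (f ⁻¹' s), ← hU, inter_iUnion₂, measure_biUnion_null_iff ht]
  intro x _
  have hm : MeasurableSet (f ⁻¹' s ∩ U x) := (hfm hs).inter (hUo x).measurableSet
  have h0 : ∫⁻ y in f ⁻¹' s ∩ U x, ENNReal.ofReal |(fderiv ℝ f y).det| ∂ν = 0 := by
    rw [lintegral_abs_det_fderiv_eq_addHaar_image ν hm
      (fun y _ ↦ (hf.differentiable one_ne_zero y).hasFDerivAt.hasFDerivWithinAt)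
      ((hUinj x).mono inter_subset_right)]
    exact measure_mono_null ((image_mono inter_subset_left).trans (image_preimage_subset f s)) hs0
  by_contra hne
  refine ((setLIntegral_pos_iff ?_).2 ?_).ne' h0
  · exact (ContinuousLinearMap.continuous_det.comp
      (hf.continuous_fderiv one_ne_zero)).measurable.abs.ennreal_ofReal
  · convert pos_iff_ne_zero.2 hne using 2
    refine inter_eq_right.2 fun y _ ↦ ?_
    simpa using hdet y

variable {ν} {ρ q : E → ℝ≥0∞}

/-- The density of the image measure pulls back to an upper bound for the density. -/
theorem ContDiff.ae_density_le_abs_det_mul (hf : ContDiff ℝ 1 f)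
    (hdet : ∀ x, (fderiv ℝ f x).det ≠ 0) (hρ : Measurable ρ)
    (h : (ν.withDensity ρ).map f = ν.withDensity q) :
    ∀ᵐ x ∂ν, ρ x ≤ ENNReal.ofReal |(fderiv ℝ f x).det| * q (f x) := by
  obtain ⟨t, U, ht, hUo, hUinj, hU⟩ := hf.exists_countable_isOpen_injOn_cover hdet
  have hfd : ∀ s, ∀ y ∈ s, HasFDerivWithinAt f (fderiv ℝ f y) s y :=
    fun s y _ ↦ (hf.differentiable one_ne_zero y).hasFDerivAt.hasFDerivWithinAt
  rw [← Measure.restrict_univ (μ := ν), ← hU, ae_restrict_biUnion_iff _ ht]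
  intro x _
  refine ae_le_of_forall_setLIntegral_le_of_sigmaFinite hρ fun s hs _ ↦ ?_
  have hm : MeasurableSet (s ∩ U x) := hs.inter (hUo x).measurableSet
  have hinj : InjOn f (s ∩ U x) := (hUinj x).mono inter_subset_right
  have him := measurable_image_of_fderivWithin hm (hfd _) hinj
  rw [Measure.restrict_restrict hs, ← lintegral_image_eq_lintegral_abs_det_fderiv_mul ν hm
    (hfd _) hinj, ← withDensity_apply _ him, ← h,
    Measure.map_apply hf.continuous.measurable him, ← withDensity_apply _ hm]
  exact measure_mono (subset_preimage_image f _)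

theorem ContDiff.ae_density_eq_abs_det_mul_of_injective (hf : ContDiff ℝ 1 f)
    (hinj : Function.Injective f) (hρ : Measurable ρ) (hq : Measurable q)
    (h : (ν.withDensity ρ).map f = ν.withDensity q) :
    ∀ᵐ x ∂ν, ρ x = ENNReal.ofReal |(fderiv ℝ f x).det| * q (f x) := by
  have hdm : Measurable fun x ↦ ENNReal.ofReal |(fderiv ℝ f x).det| :=
    (ContinuousLinearMap.continuous_det.comp
      (hf.continuous_fderiv one_ne_zero)).measurable.abs.ennreal_ofReal
  have hfm : Measurable f := hf.continuous.measurable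
  refine ae_eq_of_forall_setLIntegral_eq_of_sigmaFinite hρ (hdm.mul (hq.comp hfm))
    fun s hs _ ↦ ?_
  have hfd : ∀ y ∈ s, HasFDerivWithinAt f (fderiv ℝ f y) s y :=
    fun y _ ↦ (hf.differentiable one_ne_zero y).hasFDerivAt.hasFDerivWithinAt
  have him := measurable_image_of_fderivWithin hs hfd hinj.injOn
  rw [← lintegral_image_eq_lintegral_abs_det_fderiv_mul ν hs hfd hinj.injOn,
    ← withDensity_apply _ him, ← h, Measure.map_apply hfm him, preimage_image_eq _ hinj,
    withDensity_apply _ hs]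

end ChangeOfVariables

/-- A finite measure absolutely continuous with respect to `ν` has a real-valued density. -/
theorem MeasureTheory.Measure.AbsolutelyContinuous.exists_real_density {α : Type*}
    [MeasurableSpace α] {m ν : Measure α} [IsFiniteMeasure m] [SigmaFinite ν] (h : m ≪ ν) :
    ∃ q : α → ℝ, (∀ y, 0 ≤ q y) ∧ Measurable q ∧
      m = ν.withDensity fun y ↦ ENNReal.ofReal (q y) := by
  refine ⟨fun y ↦ (m.rnDeriv ν y).toReal, fun _ ↦ ENNReal.toReal_nonneg,
    (m.measurable_rnDeriv ν).ennreal_toReal, ?_⟩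
  conv_lhs => rw [← Measure.withDensity_rnDeriv_eq m ν h]
  refine withDensity_congr_ae ?_
  filter_upwards [m.rnDeriv_ne_top ν] with y hy
  rw [ENNReal.ofReal_toReal hy]

/-- Change of variables for densities and differential entropy.
Let `X` have density `p` (so its law is `μ = volume.withDensity (ofReal ∘ p)`), and
let `f : ℝ^d → ℝ^d` be `C¹` with everywhere nonzero Jacobian determinant.
(i) If `f` is injective, then `f(X)` has a density `q` and
    `H(f(X)) = H(X) + E_X[log |det Df(X)|]`.
(ii) If instead every point has at most countably many preimages under `f`, then
    `f(X)` has a density `q` with `q (f x) ≥ p x / |det Df x|` for a.e. `x`, and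
    consequently `H(f(X)) ≤ H(X) + E_X[log |det Df(X)|]` (whenever `H(f(X))` is
    defined). -/
theorem entropy_change_of_variables {d : ℕ} (hd : 0 < d)
    (p : EuclideanSpace ℝ (Fin d) → ℝ) (hp0 : ∀ x, 0 ≤ p x) (hpmeas : Measurable p)
    (μ : Measure (EuclideanSpace ℝ (Fin d)))
    (hμ : μ = volume.withDensity fun x => ENNReal.ofReal (p x))
    (hprob : IsProbabilityMeasure μ)
    (f : EuclideanSpace ℝ (Fin d) → EuclideanSpace ℝ (Fin d))
    (hf : ContDiff ℝ 1 f)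
    (hdet : ∀ x, (fderiv ℝ f x).det ≠ 0)
    (hHX : Integrable (fun x => Real.log (p x)) μ)
    (hJint : Integrable (fun x => Real.log |(fderiv ℝ f x).det|) μ) :
    (Function.Injective f →
      ∃ q : EuclideanSpace ℝ (Fin d) → ℝ, (∀ y, 0 ≤ q y) ∧ Measurable q ∧
        μ.map f = volume.withDensity (fun y => ENNReal.ofReal (q y)) ∧
        ∫ y, -Real.log (q y) ∂(μ.map f)
          = (∫ x, -Real.log (p x) ∂μ) + ∫ x, Real.log |(fderiv ℝ f x).det| ∂μ) ∧
    ((∀ y, (f ⁻¹' {y}).Countable) →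
      ∃ q : EuclideanSpace ℝ (Fin d) → ℝ, (∀ y, 0 ≤ q y) ∧ Measurable q ∧
        μ.map f = volume.withDensity (fun y => ENNReal.ofReal (q y)) ∧
        (∀ᵐ x ∂volume, p x / |(fderiv ℝ f x).det| ≤ q (f x)) ∧
        (Integrable (fun y => Real.log (q y)) (μ.map f) →
          ∫ y, -Real.log (q y) ∂(μ.map f)
            ≤ (∫ x, -Real.log (p x) ∂μ) + ∫ x, Real.log |(fderiv ℝ f x).det| ∂μ)) := by
  have hfm : Measurable f := hf.continuous.measurable
  have hpm : Measurable fun x ↦ ENNReal.ofReal (p x) := hpmeas.ennreal_ofReal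
  have hdpos : ∀ x, 0 < |(fderiv ℝ f x).det| := fun x ↦ abs_pos.2 (hdet x)
  have hac : μ.map f ≪ volume := by
    refine Measure.AbsolutelyContinuous.trans (Measure.AbsolutelyContinuous.map ?_ hfm)
      (hf.quasiMeasurePreserving_of_det_ne_zero volume hdet).absolutelyContinuous
    rw [hμ]
    exact withDensity_absolutelyContinuous _ _
  obtain ⟨q, hq0, hqm, hq⟩ := hac.exists_real_density
  have hq' : (volume.withDensity fun x ↦ ENNReal.ofReal (p x)).map f =
      volume.withDensity fun y ↦ ENNReal.ofReal (q y) := hμ ▸ hq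
  have hmap : ∫ y, -Real.log (q y) ∂(μ.map f) = ∫ x, -Real.log (q (f x)) ∂μ :=
    integral_map hfm.aemeasurable hqm.log.neg.aestronglyMeasurable
  have hrhs : (∫ x, -Real.log (p x) ∂μ) + ∫ x, Real.log |(fderiv ℝ f x).det| ∂μ =
      ∫ x, (-Real.log (p x) + Real.log |(fderiv ℝ f x).det|) ∂μ :=
    (integral_add hHX.neg hJint).symm
  refine ⟨fun hinj ↦ ⟨q, hq0, hqm, hq, ?_⟩, fun _ ↦ ⟨q, hq0, hqm, hq, ?_⟩⟩
  · rw [hmap, hrhs]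
    refine integral_congr_ae ?_
    rw [hμ, Filter.EventuallyEq, ae_withDensity_iff hpm]
    filter_upwards [hf.ae_density_eq_abs_det_mul_of_injective hinj hpm hqm.ennreal_ofReal hq']
      with x hx hpx
    rw [← ENNReal.ofReal_mul (hdpos x).le,
      ENNReal.ofReal_eq_ofReal_iff (hp0 x) (mul_nonneg (hdpos x).le (hq0 _))] at hx
    have hppos : 0 < p x := by simpa using hpx
    have hqx : q (f x) ≠ 0 := fun h0 ↦ by simp [hx, h0] at hppos
    rw [hx, Real.log_mul (hdpos x).ne' hqx]
    ring
  · have hle : ∀ᵐ x ∂volume, p x / |(fderiv ℝ f x).det| ≤ q (f x) := by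
      filter_upwards [hf.ae_density_le_abs_det_mul hdet hpm hq'] with x hx
      rw [← ENNReal.ofReal_mul (hdpos x).le,
        ENNReal.ofReal_le_ofReal_iff (mul_nonneg (hdpos x).le (hq0 _))] at hx
      rwa [div_le_iff₀' (hdpos x)]
    refine ⟨hle, fun hint ↦ ?_⟩
    rw [hmap, hrhs]
    refine integral_mono_ae (hint.comp_measurable hfm).neg (hHX.neg.add hJint) ?_
    rw [hμ, Filter.EventuallyLE, ae_withDensity_iff hpm]
    filter_upwards [hle] with x hx hpx
    have hppos : 0 < p x := by simpa using hpx
    have := Real.log_le_log (div_pos hppos (hdpos x)) hx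
    rw [Real.log_div hppos.ne' (hdpos x).ne'] at this
    linarith
end

section
/- Let v and g be random vectors in ℝⁿ, let S be a random n×n matrix, let ρ(v) be a random vector in ℝⁿ and R(v) a random n×n matrix (the Jacobian of the residual function ρ at v), with all quantities having finite second moments and all quadratic expectations appearing below nonzero. Define k = Q[‖Sv‖₂]/Q[‖ρ(v)‖₂] and r = (Q[‖R(v)ᵀg‖₂]·Q[‖v‖₂])/(Q[‖ρ(v)‖₂]·Q[‖g‖₂]). Assume: (1) E[⟨Sv, ρ(v)⟩] = 0; (2) E[⟨R(v)ᵀg, Sᵀg⟩] = 0; (3) (Q[‖Sᵀg‖₂]·Q[‖v‖₂])/(Q[‖Sv‖₂]·Q[‖g‖₂]) = 1. Then (Q[‖R(v)ᵀg + Sᵀg‖₂]·Q[‖v‖₂]) / (Q[‖ρ(v) + Sv‖₂]·Q[‖g‖₂]) = √(k² + r²)/√(k² + 1); in particular, for fixed k this equals 1 + (r−1)/(k²+1) + O((r−1)²) as r → 1. In words: k-diluting a residual block that would cause the gradient scale coefficient to grow at rate r with an uncorrelated linear skip connection reduces the growth rate to 1 + (r−1)/(k²+1) + O((r−1)²). 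-/
open MeasureTheory Matrix Asymptotics
open scoped RealInnerProductSpace

/-- The quadratic expectation `Q[Z] = (E[Z²])^(1/2)` of a real random variable. -/
noncomputable def Qexp {Ω : Type*} [MeasurableSpace Ω] (P : Measure Ω) (Z : Ω → ℝ) : ℝ :=
  Real.sqrt (∫ ω, Z ω ^ 2 ∂P)

theorem Qexp_nonneg {Ω : Type*} [MeasurableSpace Ω] (P : Measure Ω) (Z : Ω → ℝ) :
    0 ≤ Qexp P Z :=
  Real.sqrt_nonneg _

theorem Qexp_sq {Ω : Type*} [MeasurableSpace Ω] (P : Measure Ω) (Z : Ω → ℝ) :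
    Qexp P Z ^ 2 = ∫ ω, Z ω ^ 2 ∂P :=
  Real.sq_sqrt (integral_nonneg fun _ => sq_nonneg _)

/-- Pythagoras for quadratic expectations of uncorrelated random vectors. -/
theorem Qexp_norm_add {Ω E : Type*} [MeasurableSpace Ω] [NormedAddCommGroup E]
    [InnerProductSpace ℝ E] (P : Measure Ω) {x y : Ω → E}
    (hx : Integrable (fun ω => ‖x ω‖ ^ 2) P) (hy : Integrable (fun ω => ‖y ω‖ ^ 2) P)
    (hxy : Integrable (fun ω => ⟪x ω, y ω⟫) P) (h : ∫ ω, ⟪x ω, y ω⟫ ∂P = 0) :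
    Qexp P (fun ω => ‖x ω + y ω‖)
      = Real.sqrt (Qexp P (fun ω => ‖x ω‖) ^ 2 + Qexp P (fun ω => ‖y ω‖) ^ 2) := by
  rw [Qexp_sq, Qexp_sq, Qexp]
  congr 1
  simp_rw [norm_add_sq_real]
  rw [integral_add (by exact hx.add (hxy.const_mul 2)) hy, integral_add hx (hxy.const_mul 2),
    integral_const_mul, h]
  ring

/-- The scale-coefficient ratio of a sum of two blocks in terms of the individual ones. -/
theorem sqrt_ratio_eq {p q b c V G : ℝ} (hb : 0 < b) (hV : 0 < V) (hG : 0 < G)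
    (h : q * V = c * G) :
    Real.sqrt (p ^ 2 + q ^ 2) * V / (Real.sqrt (b ^ 2 + c ^ 2) * G)
      = Real.sqrt ((c / b) ^ 2 + (p * V / (b * G)) ^ 2) / Real.sqrt ((c / b) ^ 2 + 1) := by
  have e1 : (c / b) ^ 2 + (p * V / (b * G)) ^ 2 = (V / (b * G)) ^ 2 * (p ^ 2 + q ^ 2) := by
    have hc : c / b = q * V / (b * G) := by
      rw [h]
      field_simp
    rw [hc]
    ring
  have e2 : (c / b) ^ 2 + 1 = (1 / b) ^ 2 * (b ^ 2 + c ^ 2) := by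
    field_simp
    ring
  have hs : Real.sqrt (b ^ 2 + c ^ 2) ≠ 0 := by positivity
  rw [e1, e2, Real.sqrt_mul (sq_nonneg _), Real.sqrt_mul (sq_nonneg _),
    Real.sqrt_sq (by positivity), Real.sqrt_sq (by positivity)]
  field_simp

/-- Quantitative first-order expansion of the diluted growth rate. -/
theorem abs_diluted_rate_sub_le (k : ℝ) {r : ℝ} (hr : 0 ≤ r) :
    |Real.sqrt (k ^ 2 + r ^ 2) / Real.sqrt (k ^ 2 + 1) - (1 + (r - 1) / (k ^ 2 + 1))|
      ≤ (r - 1) ^ 2 := by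
  have hs : 0 < k ^ 2 + 1 := by positivity
  have hm : Real.sqrt (k ^ 2 + r ^ 2) / Real.sqrt (k ^ 2 + 1) - (1 + (r - 1) / (k ^ 2 + 1))
      = (Real.sqrt ((k ^ 2 + r ^ 2) * (k ^ 2 + 1)) - (k ^ 2 + r)) / (k ^ 2 + 1) := by
    rw [Real.sqrt_mul (by positivity), div_eq_mul_inv, ← Real.sqrt_div_self]
    field_simp
    ring
  have hlow : k ^ 2 + r ≤ Real.sqrt ((k ^ 2 + r ^ 2) * (k ^ 2 + 1)) := by
    apply Real.le_sqrt_of_sq_le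
    nlinarith [sq_nonneg (k * (r - 1))]
  have hup : Real.sqrt ((k ^ 2 + r ^ 2) * (k ^ 2 + 1)) ≤ k ^ 2 + r + (r - 1) ^ 2 := by
    apply Real.sqrt_le_iff.mpr ⟨by positivity, ?_⟩
    nlinarith [sq_nonneg (k * (r - 1)), mul_nonneg hr (sq_nonneg (r - 1)),
      sq_nonneg ((r - 1) ^ 2)]
  rw [hm, abs_of_nonneg (div_nonneg (by linarith) hs.le), div_le_iff₀ hs]
  nlinarith [sq_nonneg (k * (r - 1))]

/-- `k`-diluting a residual block that would cause the gradient
scale coefficient to grow at rate `r` with an uncorrelated linear skip connection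
reduces the growth rate to `√(k² + r²)/√(k² + 1)`, which for fixed `k` equals
`1 + (r−1)/(k²+1) + O((r−1)²)` as `r → 1`. -/
theorem dilution_reduces_gsc_growth {n : ℕ} {Ω : Type*} [MeasurableSpace Ω]
    (P : Measure Ω) [IsProbabilityMeasure P]
    (v g ρv : Ω → EuclideanSpace ℝ (Fin n))
    (S Rv : Ω → Matrix (Fin n) (Fin n) ℝ)
    -- all quantities have finite second moments
    (hm1 : Integrable (fun ω => ‖v ω‖ ^ 2) P)
    (hm2 : Integrable (fun ω => ‖g ω‖ ^ 2) P)
    (hm3 : Integrable (fun ω => ‖ρv ω‖ ^ 2) P)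
    (hm4 : Integrable (fun ω => ‖Matrix.toEuclideanLin (S ω) (v ω)‖ ^ 2) P)
    (hm5 : Integrable (fun ω => ‖Matrix.toEuclideanLin (Rv ω)ᵀ (g ω)‖ ^ 2) P)
    (hm6 : Integrable (fun ω => ‖Matrix.toEuclideanLin (S ω)ᵀ (g ω)‖ ^ 2) P)
    (hm7 : Integrable (fun ω => ⟪Matrix.toEuclideanLin (S ω) (v ω), ρv ω⟫) P)
    (hm8 : Integrable (fun ω =>
      ⟪Matrix.toEuclideanLin (Rv ω)ᵀ (g ω), Matrix.toEuclideanLin (S ω)ᵀ (g ω)⟫) P)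
    (k r : ℝ)
    -- definitions of the dilution level `k` and the undiluted growth rate `r`
    (hk : k = Qexp P (fun ω => ‖Matrix.toEuclideanLin (S ω) (v ω)‖)
        / Qexp P (fun ω => ‖ρv ω‖))
    (hr : r = Qexp P (fun ω => ‖Matrix.toEuclideanLin (Rv ω)ᵀ (g ω)‖)
          * Qexp P (fun ω => ‖v ω‖)
        / (Qexp P (fun ω => ‖ρv ω‖) * Qexp P (fun ω => ‖g ω‖)))
    -- (1) skip block and residual block are uncorrelated
    (h1 : ∫ ω, ⟪Matrix.toEuclideanLin (S ω) (v ω), ρv ω⟫ ∂P = 0)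
    -- (2) the gradients flowing through them are uncorrelated
    (h2 : ∫ ω, ⟪Matrix.toEuclideanLin (Rv ω)ᵀ (g ω),
        Matrix.toEuclideanLin (S ω)ᵀ (g ω)⟫ ∂P = 0)
    -- (3) the skip block preserves the gradient scale coefficient
    (h3 : Qexp P (fun ω => ‖Matrix.toEuclideanLin (S ω)ᵀ (g ω)‖)
          * Qexp P (fun ω => ‖v ω‖)
        / (Qexp P (fun ω => ‖Matrix.toEuclideanLin (S ω) (v ω)‖)
          * Qexp P (fun ω => ‖g ω‖)) = 1)
    -- the quadratic expectations appearing are nonzero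
    (hq1 : Qexp P (fun ω => ‖v ω‖) ≠ 0)
    (hq2 : Qexp P (fun ω => ‖g ω‖) ≠ 0)
    (hq3 : Qexp P (fun ω => ‖ρv ω‖) ≠ 0)
    (hq4 : Qexp P (fun ω => ‖Matrix.toEuclideanLin (S ω) (v ω)‖) ≠ 0)
    (hq5 : Qexp P (fun ω => ‖ρv ω + Matrix.toEuclideanLin (S ω) (v ω)‖) ≠ 0) :
    Qexp P (fun ω => ‖Matrix.toEuclideanLin (Rv ω)ᵀ (g ω)
          + Matrix.toEuclideanLin (S ω)ᵀ (g ω)‖) * Qexp P (fun ω => ‖v ω‖)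
        / (Qexp P (fun ω => ‖ρv ω + Matrix.toEuclideanLin (S ω) (v ω)‖)
          * Qexp P (fun ω => ‖g ω‖))
      = Real.sqrt (k ^ 2 + r ^ 2) / Real.sqrt (k ^ 2 + 1) ∧
    (fun r' : ℝ => Real.sqrt (k ^ 2 + r' ^ 2) / Real.sqrt (k ^ 2 + 1)
        - (1 + (r' - 1) / (k ^ 2 + 1))) =O[nhds 1] (fun r' : ℝ => (r' - 1) ^ 2) := by
  have hV := (Qexp_nonneg P fun ω => ‖v ω‖).lt_of_ne' hq1
  have hG := (Qexp_nonneg P fun ω => ‖g ω‖).lt_of_ne' hq2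
  have hb := (Qexp_nonneg P fun ω => ‖ρv ω‖).lt_of_ne' hq3
  refine ⟨?_, ?_⟩
  · rw [Qexp_norm_add P hm5 hm6 hm8 h2,
      Qexp_norm_add P hm3 hm4 (by simpa only [real_inner_comm] using hm7)
        (by simpa only [real_inner_comm] using h1), hk, hr]
    exact sqrt_ratio_eq hb hV hG ((div_eq_one_iff_eq (mul_ne_zero hq4 hq2)).mp h3)
  · refine IsBigO.of_bound 1 ?_
    filter_upwards [lt_mem_nhds (zero_lt_one' ℝ)] with r' hr'
    rw [one_mul, Real.norm_eq_abs, Real.norm_of_nonneg (sq_nonneg _)]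
    exact abs_diluted_rate_sub_le k hr'.le
end

section
/- For every real number r > 1 and every positive integer i, the following inequality holds: (1/16)^{i+1} · (ln r)^{2i+3} · r^{−(i²/4 + i/4 + 1)} · i^i ≤ 1. -/
/-- The base of the `i`-th power in `ν(r, i)`, in terms of `L = ln r`, is dominated by an
exponential. -/
theorem sq_mul_div_sixteen_le_exp {L x : ℝ} (hL : 0 ≤ L) (hx : 0 ≤ x) :
    L ^ 2 * x / 16 ≤ Real.exp (L * (x + 1) / 4) := by
  have h := Real.quadratic_le_exp_of_nonneg (x := L * (x + 1) / 4) (by positivity)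
  have h1 : 0 ≤ L * (x + 1) / 4 := by positivity
  nlinarith [mul_nonneg (sq_nonneg L) hx, mul_nonneg (sq_nonneg L) (sq_nonneg (x - 1))]

theorem cube_div_sixteen_le_exp {L : ℝ} (hL : 0 ≤ L) : L ^ 3 / 16 ≤ Real.exp L := by
  have h := Real.pow_div_factorial_le_exp L hL 3
  norm_num [Nat.factorial] at h
  linarith [pow_nonneg hL 3]

/-- For every real `r > 1` and every positive integer `i`,
`(1/16)^(i+1) · (ln r)^(2i+3) · r^(−(i²/4 + i/4 + 1)) · i^i ≤ 1`. -/
theorem nu_le_one (r : ℝ) (hr : 1 < r) (i : ℕ) (hi : 1 ≤ i) :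
    (1 / 16 : ℝ) ^ (i + 1) * Real.log r ^ (2 * i + 3)
        * r ^ (-((i : ℝ) ^ 2 / 4 + (i : ℝ) / 4 + 1)) * (i : ℝ) ^ i ≤ 1 := by
  have hL : 0 ≤ Real.log r := (Real.log_pos hr).le
  rw [Real.rpow_def_of_pos (by linarith)]
  set L := Real.log r
  have hexp : Real.exp (L * -((i : ℝ) ^ 2 / 4 + (i : ℝ) / 4 + 1))
      = (Real.exp (L * (i + 1) / 4) ^ i * Real.exp L)⁻¹ := by
    rw [← Real.exp_nat_mul, ← Real.exp_add, ← Real.exp_neg]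
    congr 1
    ring
  have hsplit : (1 / 16 : ℝ) ^ (i + 1) * L ^ (2 * i + 3) * (i : ℝ) ^ i
      = (L ^ 2 * i / 16) ^ i * (L ^ 3 / 16) := by
    rw [div_pow (L ^ 2 * i), mul_pow, ← pow_mul, div_pow, one_pow]
    field_simp
    ring
  rw [mul_right_comm, hsplit, hexp, ← div_eq_mul_inv, div_le_one (by positivity)]
  have h1 := sq_mul_div_sixteen_le_exp hL (Nat.cast_nonneg (α := ℝ) i)
  have h2 := cube_div_sixteen_le_exp hL
  gcongr
end
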